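/- (Cullen's lemma.) Let Ω ⊆ H be an open set disjoint from the real axis and let f = u + ιv be a complex-like, ℝ-differentiable function on Ω. Then f is hyperholomorphic on Ω if and only if for all p ∈ Ω: D_l(q ↦ f(q)/r(q)²)(p) = −(2/r(p)³)·u(p)·ι(p). -/

import Mathlib

open Quaternion MeasureTheory

noncomputable section

/-- `r(p)` : distance from the real axis. -/
def rr (p : ℍ[ℝ]) : ℝ := Real.sqrt (p.imI ^ 2 + p.imJ ^ 2 + p.imK ^ 2)

def qi : ℍ[ℝ] := ⟨0, 1, 0, 0⟩
def qj : ℍ[ℝ] := ⟨0, 0, 1, 0⟩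
def qk : ℍ[ℝ] := ⟨0, 0, 0, 1⟩

/-- imaginary part of a quaternion -/
def qim (p : ℍ[ℝ]) : ℍ[ℝ] := ⟨0, p.imI, p.imJ, p.imK⟩

/-- `ι(p)` -/
def iota (p : ℍ[ℝ]) : ℍ[ℝ] := (rr p)⁻¹ • qim p

/-- left Fueter operator -/
def Dl (f : ℍ[ℝ] → ℍ[ℝ]) (p : ℍ[ℝ]) : ℍ[ℝ] :=
  fderiv ℝ f p 1 + qi * fderiv ℝ f p qi + qj * fderiv ℝ f p qj + qk * fderiv ℝ f p qk

/-- right Fueter operator -/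
def Dr (f : ℍ[ℝ] → ℍ[ℝ]) (p : ℍ[ℝ]) : ℍ[ℝ] :=
  fderiv ℝ f p 1 + fderiv ℝ f p qi * qi + fderiv ℝ f p qj * qj + fderiv ℝ f p qk * qk

/-- hyperholomorphic on `Ω` with decomposition `f = u + ι v` -/
def Hyperholo (Ω : Set ℍ[ℝ]) (f : ℍ[ℝ] → ℍ[ℝ]) (u v : ℍ[ℝ] → ℝ) : Prop :=
  (∀ p ∈ Ω, DifferentiableAt ℝ f p) ∧
  (∀ p ∈ Ω, f p = (u p : ℍ[ℝ]) + iota p * (v p : ℍ[ℝ])) ∧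
  (∀ p ∈ Ω, Dl f p = ((-2 * v p / rr p : ℝ) : ℍ[ℝ]))

/-- spherical parametrization of the imaginary unit sphere -/
def iotaSph (α β : ℝ) : ℍ[ℝ] :=
  ⟨0, Real.cos α * Real.sin β, Real.sin α * Real.sin β, Real.cos β⟩

/-- the point `t + r·ι(α,β)` -/
def pt (t r α β : ℝ) : ℍ[ℝ] := (t : ℍ[ℝ]) + (r : ℍ[ℝ]) * iotaSph α β

@[simp] theorem re_qi : qi.re = 0 := rfl

@[simp] theorem imI_qi : qi.imI = 1 := rfl

@[simp] theorem imJ_qi : qi.imJ = 0 := rfl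

@[simp] theorem imK_qi : qi.imK = 0 := rfl

@[simp] theorem re_qj : qj.re = 0 := rfl

@[simp] theorem imI_qj : qj.imI = 0 := rfl

@[simp] theorem imJ_qj : qj.imJ = 1 := rfl

@[simp] theorem imK_qj : qj.imK = 0 := rfl

@[simp] theorem re_qk : qk.re = 0 := rfl

@[simp] theorem imI_qk : qk.imI = 0 := rfl

@[simp] theorem imJ_qk : qk.imJ = 0 := rfl

@[simp] theorem imK_qk : qk.imK = 1 := rfl

@[simp] theorem re_qim (p : ℍ[ℝ]) : (qim p).re = 0 := rfl

@[simp] theorem imI_qim (p : ℍ[ℝ]) : (qim p).imI = p.imI := rfl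

@[simp] theorem imJ_qim (p : ℍ[ℝ]) : (qim p).imJ = p.imJ := rfl

@[simp] theorem imK_qim (p : ℍ[ℝ]) : (qim p).imK = p.imK := rfl

theorem rr_sq (p : ℍ[ℝ]) : rr p ^ 2 = p.imI ^ 2 + p.imJ ^ 2 + p.imK ^ 2 :=
  Real.sq_sqrt (by positivity)

theorem rr_ne_zero {p : ℍ[ℝ]} (hp : qim p ≠ 0) : rr p ≠ 0 := by
  contrapose! hp
  have h := rr_sq p
  rw [hp] at h
  have hI : p.imI = 0 := by nlinarith [sq_nonneg p.imI, sq_nonneg p.imJ, sq_nonneg p.imK]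
  have hJ : p.imJ = 0 := by nlinarith [sq_nonneg p.imI, sq_nonneg p.imJ, sq_nonneg p.imK]
  have hK : p.imK = 0 := by nlinarith [sq_nonneg p.imI, sq_nonneg p.imJ, sq_nonneg p.imK]
  ext <;> simp [hI, hJ, hK]

theorem iota_mul_self {p : ℍ[ℝ]} (hp : qim p ≠ 0) : iota p * iota p = -1 := by
  have hr := rr_ne_zero hp
  have h := rr_sq p
  ext
  · simp [iota]
    field_simp
    linarith
  all_goals simp [iota, mul_comm]

/-- The coordinate `imI` as a continuous linear map. -/
def imICLM : ℍ[ℝ] →L[ℝ] ℝ := ⟨QuaternionAlgebra.imIₗ (-1) 0 (-1), Quaternion.continuous_imI⟩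

/-- The coordinate `imJ` as a continuous linear map. -/
def imJCLM : ℍ[ℝ] →L[ℝ] ℝ := ⟨QuaternionAlgebra.imJₗ (-1) 0 (-1), Quaternion.continuous_imJ⟩

/-- The coordinate `imK` as a continuous linear map. -/
def imKCLM : ℍ[ℝ] →L[ℝ] ℝ := ⟨QuaternionAlgebra.imKₗ (-1) 0 (-1), Quaternion.continuous_imK⟩

@[simp] theorem imICLM_apply (p : ℍ[ℝ]) : imICLM p = p.imI := rfl

@[simp] theorem imJCLM_apply (p : ℍ[ℝ]) : imJCLM p = p.imJ := rfl

@[simp] theorem imKCLM_apply (p : ℍ[ℝ]) : imKCLM p = p.imK := rfl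

theorem hasFDerivAt_rr_sq (p : ℍ[ℝ]) :
    HasFDerivAt (fun q => rr q ^ 2)
      ((2 * p.imI) • imICLM + (2 * p.imJ) • imJCLM + (2 * p.imK) • imKCLM) p := by
  have h := ((imICLM.hasFDerivAt (x := p)).pow 2).add ((imJCLM.hasFDerivAt (x := p)).pow 2)
    |>.add ((imKCLM.hasFDerivAt (x := p)).pow 2)
  have hfun : (fun q => rr q ^ 2)
      = (((fun q => imICLM q ^ 2) + fun q => imJCLM q ^ 2) + fun q => imKCLM q ^ 2) :=
    funext rr_sq
  rw [hfun]
  simpa using h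

/-- Leibniz rule for the left Fueter operator and a real-valued factor. -/
theorem Dl_smul {c : ℍ[ℝ] → ℝ} {c' : ℍ[ℝ] →L[ℝ] ℝ} {f : ℍ[ℝ] → ℍ[ℝ]} {p : ℍ[ℝ]}
    (hc : HasFDerivAt c c' p) (hf : DifferentiableAt ℝ f p) :
    Dl (fun q => c q • f q) p
      = c p • Dl f p + (c' 1 • 1 + c' qi • qi + c' qj • qj + c' qk • qk) * f p := by
  have hd : fderiv ℝ (fun q => c q • f q) p = c p • fderiv ℝ f p + c'.smulRight (f p) :=
    (hc.smul hf.hasFDerivAt).fderiv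
  simp only [Dl, hd, add_apply, smul_apply,
    ContinuousLinearMap.smulRight_apply, mul_add, add_mul, smul_add, mul_smul_comm,
    smul_mul_assoc, one_mul]
  abel

theorem Dl_div_rr_sq {f : ℍ[ℝ] → ℍ[ℝ]} {p : ℍ[ℝ]} (hp : qim p ≠ 0)
    (hf : DifferentiableAt ℝ f p) :
    Dl (fun q => f q / ((rr q ^ 2 : ℝ) : ℍ[ℝ])) p
      = (rr p ^ 2)⁻¹ • Dl f p - (2 / rr p ^ 3) • (iota p * f p) := by
  have hr := rr_ne_zero hp
  have hfun : (fun q => f q / ((rr q ^ 2 : ℝ) : ℍ[ℝ])) = fun q => (rr q ^ 2)⁻¹ • f q := by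
    funext q
    rw [div_eq_mul_inv, ← Quaternion.coe_inv, Quaternion.mul_coe_eq_smul]
  have hc := (hasDerivAt_inv (pow_ne_zero 2 hr)).comp_hasFDerivAt p (hasFDerivAt_rr_sq p)
  have h := Dl_smul hc hf
  rw [hfun]
  refine h.trans ?_
  rw [sub_eq_add_neg, ← smul_mul_assoc, ← neg_mul]
  congr 2
  ext <;> simp [iota] <;> field_simp

/-- Cullen's lemma: a complex-like, ℝ-differentiable function is hyperholomorphic iff
`D_l(f/r²) = -(2/r³)·u·ι`. -/
theorem cullen_lemma (Ω : Set ℍ[ℝ]) (hΩ : IsOpen Ω)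
    (hax : ∀ p ∈ Ω, qim p ≠ 0)
    (f : ℍ[ℝ] → ℍ[ℝ]) (u v : ℍ[ℝ] → ℝ)
    (hcl : ∀ p ∈ Ω, f p = (u p : ℍ[ℝ]) + iota p * (v p : ℍ[ℝ]))
    (hdiff : ∀ p ∈ Ω, DifferentiableAt ℝ f p) :
    (∀ p ∈ Ω, Dl f p = ((-2 * v p / rr p : ℝ) : ℍ[ℝ])) ↔
      (∀ p ∈ Ω, Dl (fun q => f q / ((rr q ^ 2 : ℝ) : ℍ[ℝ])) p
          = -((2 / rr p ^ 3 : ℝ) : ℍ[ℝ]) * (u p : ℍ[ℝ]) * iota p) := by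
  refine forall₂_congr fun p hp => ?_
  have hr := rr_ne_zero (hax p hp)
  have key : Dl (fun q => f q / ((rr q ^ 2 : ℝ) : ℍ[ℝ])) p
      - -((2 / rr p ^ 3 : ℝ) : ℍ[ℝ]) * (u p : ℍ[ℝ]) * iota p
      = (rr p ^ 2)⁻¹ • (Dl f p - ((-2 * v p / rr p : ℝ) : ℍ[ℝ])) := by
    rw [Dl_div_rr_sq (hax p hp) (hdiff p hp), hcl p hp, mul_add, ← mul_assoc,
      iota_mul_self (hax p hp)]
    ext <;> simp [-Quaternion.coe_div] <;> field_simp <;> ring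
  rw [← sub_eq_zero, ← sub_eq_zero (b := -_ * _ * _), key, smul_eq_zero]
  simp [hr]
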